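/- arXiv:1902.09013 — 10 statements merged into one kernel-verified Lean document; each statement's English description precedes it below -/
import Mathlib

section
/- Let W be a real inner product space, T ≥ 1, and 𝔤 > 0. Let g_1,...,g_T ∈ W (loss vectors) and w_1,...,w_T ∈ W (played points). Define h_1 = 𝔤, h_{t+1} = max(h_t, ‖g_t‖), and the truncated gradients g^trunc_t = (h_t/‖g_t‖)·g_t if ‖g_t‖ ≥ h_t and g^trunc_t = g_t otherwise. Let G = max_{1≤t≤T} ‖g_t‖ and let ẘ ∈ W. If Σ_{t=1}^T ⟨g^trunc_t, w_t − ẘ⟩ ≤ R for some real R, then Σ_{t=1}^T ⟨g_t, w_t − ẘ⟩ ≤ R + G · max_{1≤t≤T} ‖w_t‖ + G‖ẘ‖. -/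
/-- Rescaling a vector to norm `a` when its norm is at least `a` moves it by the excess norm. -/
theorem norm_sub_truncate {W : Type*} [NormedAddCommGroup W] [NormedSpace ℝ W]
    (x : W) {a : ℝ} (ha : 0 < a) :
    ‖x - (if a ≤ ‖x‖ then (a / ‖x‖) • x else x)‖ = max a ‖x‖ - a := by
  split_ifs with hax
  · have hx : 0 < ‖x‖ := ha.trans_le hax
    have hdiv : a / ‖x‖ ≤ 1 := (div_le_one hx).mpr hax
    have hsub : x - (a / ‖x‖) • x = (1 - a / ‖x‖) • x := by rw [sub_smul, one_smul]
    rw [hsub, norm_smul, Real.norm_of_nonneg (sub_nonneg.mpr hdiv), max_eq_right hax]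
    field_simp
  · simp [max_eq_left (not_le.mp hax).le]


open Finset RealInnerProductSpace in
/-- hint-removal reduction (Algorithm 2 / Theorem 2). `wc` is the comparator ẘ,
`gtrunc` the truncated gradients, `G` the maximum gradient norm. -/
theorem stmt_1 {W : Type*} [NormedAddCommGroup W] [InnerProductSpace ℝ W]
    (T : ℕ) (hT : 1 ≤ T) (𝔤 : ℝ) (h𝔤 : 0 < 𝔤)
    (g w gtrunc : ℕ → W) (h : ℕ → ℝ)
    (hh1 : h 1 = 𝔤)
    (hh : ∀ t ∈ Icc 1 T, h (t + 1) = max (h t) ‖g t‖)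
    (htrunc : ∀ t ∈ Icc 1 T,
      gtrunc t = if h t ≤ ‖g t‖ then (h t / ‖g t‖) • g t else g t)
    (G : ℝ) (hG : G = (Icc 1 T).sup' (Finset.nonempty_Icc.mpr hT) fun t => ‖g t‖)
    (wc : W) (R : ℝ)
    (hR : ∑ t ∈ Icc 1 T, ⟪gtrunc t, w t - wc⟫ ≤ R) :
    ∑ t ∈ Icc 1 T, ⟪g t, w t - wc⟫ ≤
      R + G * ((Icc 1 T).sup' (Finset.nonempty_Icc.mpr hT) fun t => ‖w t‖) + G * ‖wc‖ := by
  set M := (Icc 1 T).sup' (Finset.nonempty_Icc.mpr hT) fun t => ‖w t‖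
  have hgG : ∀ t ∈ Icc 1 T, ‖g t‖ ≤ G := fun t ht =>
    hG ▸ Finset.le_sup' (fun t => ‖g t‖) ht
  have hwM : ∀ t ∈ Icc 1 T, ‖w t‖ ≤ M := fun t ht => Finset.le_sup' (fun t => ‖w t‖) ht
  have h1T : 1 ∈ Icc 1 T := by simp [hT]
  have hG0 : 0 ≤ G := (norm_nonneg _).trans (hgG 1 h1T)
  have hM0 : 0 ≤ M := (norm_nonneg _).trans (hwM 1 h1T)
  have hbound : ∀ t, t ≤ T → 𝔤 ≤ h (t + 1) ∧ h (t + 1) ≤ 𝔤 + G := by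
    intro t
    induction t with
    | zero => intro _; simp [hh1, hG0]
    | succ n ih =>
      intro hn
      have hmem : n + 1 ∈ Icc 1 T := by simp [hn]
      obtain ⟨hlo, hhi⟩ := ih (by omega)
      rw [hh _ hmem]
      exact ⟨le_max_of_le_left hlo, max_le hhi (by linarith [hgG _ hmem])⟩
  have hdiff : ∀ t ∈ Icc 1 T, ‖g t - gtrunc t‖ = h (t + 1) - h t := by
    intro t ht
    obtain ⟨ht1, htT⟩ := mem_Icc.mp ht
    have hpos : 0 < h t := by
      have hlo := (hbound (t - 1) (by omega)).1
      rw [Nat.sub_add_cancel ht1] at hlo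
      linarith
    rw [htrunc t ht, norm_sub_truncate _ hpos, hh t ht]
  have hterm : ∀ t ∈ Icc 1 T,
      ⟪g t, w t - wc⟫ ≤ ⟪gtrunc t, w t - wc⟫ + (h (t + 1) - h t) * (M + ‖wc‖) := by
    intro t ht
    have hw : ‖w t - wc‖ ≤ M + ‖wc‖ := (norm_sub_le _ _).trans (by gcongr; exact hwM t ht)
    rw [← sub_le_iff_le_add', ← inner_sub_left, ← hdiff t ht]
    exact (real_inner_le_norm _ _).trans (by gcongr)
  have htel : ∑ t ∈ Icc 1 T, (h (t + 1) - h t) = h (T + 1) - h 1 := by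
    rw [← Finset.Ico_add_one_right_eq_Icc, Finset.sum_Ico_sub h (by omega)]
  have hexcess : (h (T + 1) - h 1) * (M + ‖wc‖) ≤ G * (M + ‖wc‖) := by
    gcongr
    linarith [(hbound T le_rfl).2]
  have hsum := Finset.sum_le_sum hterm
  rw [Finset.sum_add_distrib, ← Finset.sum_mul, htel] at hsum
  linarith
end

section
/- Let T ≥ 1 and k > 0, p > 0, 𝔤 > 0. Let g_1,...,g_T be reals, not all zero, and w_1,...,w_T reals. Set G_t = max_{i≤t} |g_i| and G = G_T. Define: h_1 = 𝔤, h_{t+1} = max(h_t, |g_t|); B_1 = 0 and B_{t+1} = k·(Σ_{i=1}^t |g_i|/G_t)^p; the played points w̃_t = clamp(w_t, [−B_t, B_t]); the truncated gradients g^trunc_t = h_t·(g_t/|g_t|) if |g_t| ≥ h_t and g^trunc_t = g_t otherwise; the surrogate losses ℓ̃_t(w) = (1/2)(g^trunc_t·w + |g^trunc_t|·max(0, |w| − B_t)); and let g̃_t be any subgradient of ℓ̃_t at w_t, i.e. ℓ̃_t(u) ≥ ℓ̃_t(w_t) + g̃_t(u − w_t) for all u ∈ ℝ. Let ẘ ∈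 ℝ and suppose Σ_{t=1}^T g̃_t(w_t − ẘ) ≤ R for some real R. Then for every q ∈ [0,1]: Σ_{t=1}^T g_t(w̃_t − ẘ) ≤ 2R + G·k·max_{1≤t≤T}(Σ_{i=1}^t |g_i|/G_t)^p + 2G|ẘ| + G·(|ẘ|^{1+(1−q)/p} / k^{(1−q)/p})·(Σ_{t=1}^T |g_t|/G)^q. -/
lemma abs_clamp_le {b : ℝ} (hb : 0 ≤ b) (x : ℝ) : |max (-b) (min x b)| ≤ b :=
  abs_le.mpr ⟨le_max_left _ _, max_le (by linarith) (min_le_right _ _)⟩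

lemma abs_clamp_sub_le {b : ℝ} (hb : 0 ≤ b) (x : ℝ) :
    |max (-b) (min x b) - x| ≤ max 0 (|x| - b) := by
  rcases le_total x b with h | h
  · rw [min_eq_left h]
    rcases le_total (-b) x with h' | h'
    · simp [max_eq_right h']
    · rw [max_eq_left h', abs_of_nonneg (by linarith), abs_of_nonpos (by linarith)]
      exact le_max_of_le_right (by linarith)
  · rw [min_eq_right h, max_eq_right (by linarith), abs_of_nonpos (by linarith),
      abs_of_nonneg (by linarith)]
    exact le_max_of_le_right (by linarith)

lemma mul_clamp_le {b : ℝ} (hb : 0 ≤ b) (a x : ℝ) :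
    a * max (-b) (min x b) ≤ a * x + |a| * max 0 (|x| - b) := by
  have h₁ := mul_le_mul_of_nonneg_left (abs_clamp_sub_le hb x) (abs_nonneg a)
  have h₂ := le_abs_self (a * (max (-b) (min x b) - x))
  rw [abs_mul] at h₂
  linarith

lemma abs_truncation_le {h : ℝ} (hh : 0 < h) (x : ℝ) :
    |if h ≤ |x| then h * (x / |x|) else x| ≤ |x| := by
  split_ifs with hx
  · have hx' : |x| ≠ 0 := by linarith
    rwa [abs_mul, abs_div, abs_abs, div_self hx', mul_one, abs_of_pos hh]
  · exact le_rfl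

lemma abs_sub_truncation_le {h : ℝ} (hh : 0 < h) (x : ℝ) :
    |x - if h ≤ |x| then h * (x / |x|) else x| ≤ max h |x| - h := by
  split_ifs with hx
  · have hx' : 0 < |x| := by linarith
    have key : x - h * (x / |x|) = (|x| - h) * (x / |x|) := by
      field_simp
    rw [key, abs_mul, abs_div, abs_abs, div_self hx'.ne', mul_one, max_eq_right hx,
      abs_of_nonneg (by linarith)]
  · simp

/-- A sum `s` of magnitudes at most `a ≤ G` whose normalized power `k * (s / a) ^ p` stays below
`c` is controlled by an interpolation between that constraint and an upper bound `S` on `s`. -/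
lemma le_of_mul_div_rpow_le {k p q c s a S G : ℝ} (hk : 0 < k) (hp : 0 < p) (hq₀ : 0 ≤ q)
    (hq₁ : q ≤ 1) (hs : 0 ≤ s) (ha : 0 < a) (hsS : s ≤ S) (haG : a ≤ G)
    (hc : k * (s / a) ^ p ≤ c) :
    s ≤ G * (c / k) ^ ((1 - q) / p) * (S / G) ^ q := by
  have hG : 0 < G := ha.trans_le haG
  have hx : 0 ≤ s / a := by positivity
  have he : 0 ≤ (1 - q) / p := div_nonneg (by linarith) hp.le
  have hc₀ : 0 ≤ c / k := div_nonneg (le_trans (by positivity) hc) hk.le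
  have h₁ : (s / a) ^ (1 - q) ≤ (c / k) ^ ((1 - q) / p) := by
    have : (s / a) ^ p ≤ c / k := by rw [le_div_iff₀ hk]; linarith
    calc (s / a) ^ (1 - q) = ((s / a) ^ p) ^ ((1 - q) / p) := by
          rw [← Real.rpow_mul hx, mul_div_cancel₀ _ hp.ne']
      _ ≤ _ := Real.rpow_le_rpow (by positivity) this he
  have rescale : ∀ {b r : ℝ}, 0 < b → 0 ≤ r → b * (r / b) ^ q = b ^ (1 - q) * r ^ q := by
    intro b r hb hr
    rw [Real.div_rpow hr hb.le, Real.rpow_sub hb, Real.rpow_one]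
    ring
  have h₂ : a * (s / a) ^ q ≤ G * (S / G) ^ q := by
    rw [rescale ha hs, rescale hG (hs.trans hsS)]
    have := Real.rpow_le_rpow ha.le haG (by linarith : 0 ≤ 1 - q)
    have := Real.rpow_le_rpow hs hsS hq₀
    gcongr
  calc s = a * (s / a) := by field_simp
    _ = (s / a) ^ (1 - q) * (a * (s / a) ^ q) := by
      have : (s / a) ^ (1 - q) * (s / a) ^ q = s / a := by
        rw [← Real.rpow_add' hx (by norm_num), sub_add_cancel, Real.rpow_one]
      calc a * (s / a) = a * ((s / a) ^ (1 - q) * (s / a) ^ q) := by rw [this]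
        _ = _ := by ring
    _ ≤ (c / k) ^ ((1 - q) / p) * (G * (S / G) ^ q) := by gcongr
    _ = _ := by ring

open Finset in
/-- If the partial sums of `a` are at most `M` whenever the next threshold is below `c`, then the
total penalty for exceeding the thresholds is at most `c * (M + G)`. -/
lemma sum_mul_max_sub_le {a B : ℕ → ℝ} {c M G : ℝ} {T : ℕ} (hc : 0 ≤ c) (hM : 0 ≤ M) (hG : 0 ≤ G)
    (ha : ∀ t ∈ Icc 1 T, 0 ≤ a t) (haG : ∀ t ∈ Icc 1 T, a t ≤ G)
    (hB : ∀ t ∈ Icc 1 T, 0 ≤ B t)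
    (hsum : ∀ n < T, B (n + 1) ≤ c → ∑ t ∈ Icc 1 n, a t ≤ M) :
    ∑ t ∈ Icc 1 T, a t * max 0 (c - B t) ≤ c * (M + G) := by
  suffices H : ∀ n ≤ T, ∑ t ∈ Icc 1 n, a t * max 0 (c - B t) ≤ c * (M + G) from H T le_rfl
  intro n
  induction n with
  | zero => intro _; simpa using by positivity
  | succ n ih =>
    intro hn
    have hmem : n + 1 ∈ Icc 1 T := mem_Icc.mpr ⟨by omega, hn⟩
    by_cases hBc : B (n + 1) ≤ c
    · have hle : ∀ t ∈ Icc 1 (n + 1), a t * max 0 (c - B t) ≤ a t * c := by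
        intro t ht
        have ht' : t ∈ Icc 1 T := Icc_subset_Icc_right hn ht
        exact mul_le_mul_of_nonneg_left (max_le hc (by linarith [hB t ht'])) (ha t ht')
      refine (sum_le_sum hle).trans ?_
      rw [← sum_mul, mul_comm, sum_Icc_succ_top (by omega)]
      have := hsum n hn hBc
      have := haG _ hmem
      gcongr
    · rw [sum_Icc_succ_top (by omega), max_eq_left (by linarith)]
      linarith [ih (by omega)]

open Finset in
/-- the Leashed reduction (Algorithm 3 / Theorem 3). `wc` is the comparator ẘ,
`Gt t` is max_{i ≤ t} |g_i|, `B` the artificial constraints, `gtrunc` the truncated gradients,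
`gmod t` the modified (sub)gradient g̃_t of the surrogate loss
ℓ̃_t(u) = (1/2)(g^trunc_t·u + |g^trunc_t|·max(0, |u| − B_t)) at w_t, and
`max (-(B t)) (min (w t) (B t))` is the played point w̃_t = clamp(w_t, [−B_t, B_t]).
Real exponents use `Real.rpow`. -/
theorem stmt_2 (T : ℕ) (hT : 1 ≤ T) (k p 𝔤 : ℝ) (hk : 0 < k) (hp : 0 < p) (h𝔤 : 0 < 𝔤)
    (g w : ℕ → ℝ) (hgne : ∃ t ∈ Icc 1 T, g t ≠ 0)
    (Gt : ℕ → ℝ)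
    (hGt : ∀ t, ∀ ht : t ∈ Icc 1 T,
      Gt t = (Icc 1 t).sup' (Finset.nonempty_Icc.mpr (Finset.mem_Icc.mp ht).1) fun i => |g i|)
    (G : ℝ) (hG : G = Gt T)
    (h : ℕ → ℝ) (hh1 : h 1 = 𝔤)
    (hh : ∀ t ∈ Icc 1 T, h (t + 1) = max (h t) |g t|)
    (B : ℕ → ℝ) (hB1 : B 1 = 0)
    (hB : ∀ t ∈ Icc 1 T, B (t + 1) = k * ((∑ i ∈ Icc 1 t, |g i|) / Gt t) ^ p)
    (gtrunc : ℕ → ℝ)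
    (htrunc : ∀ t ∈ Icc 1 T, gtrunc t = if h t ≤ |g t| then h t * (g t / |g t|) else g t)
    (gmod : ℕ → ℝ)
    (hsubgrad : ∀ t ∈ Icc 1 T, ∀ u : ℝ,
      (1 / 2) * (gtrunc t * w t + |gtrunc t| * max 0 (|w t| - B t)) + gmod t * (u - w t) ≤
        (1 / 2) * (gtrunc t * u + |gtrunc t| * max 0 (|u| - B t)))
    (wc R : ℝ)
    (hR : ∑ t ∈ Icc 1 T, gmod t * (w t - wc) ≤ R) :
    ∀ q : ℝ, 0 ≤ q → q ≤ 1 →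
      ∑ t ∈ Icc 1 T, g t * (max (-(B t)) (min (w t) (B t)) - wc) ≤
        2 * R +
          G * k * ((Icc 1 T).sup' (Finset.nonempty_Icc.mpr hT) fun t =>
            ((∑ i ∈ Icc 1 t, |g i|) / Gt t) ^ p) +
          2 * G * |wc| +
          G * (|wc| ^ (1 + (1 - q) / p) / k ^ ((1 - q) / p)) *
            ((∑ t ∈ Icc 1 T, |g t|) / G) ^ q := by
  intro q hq₀ hq₁
  set M := (Icc 1 T).sup' (Finset.nonempty_Icc.mpr hT) fun t =>
    ((∑ i ∈ Icc 1 t, |g i|) / Gt t) ^ p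
  have hGt_ge : ∀ t ∈ Icc 1 T, ∀ i ∈ Icc 1 t, |g i| ≤ Gt t := by
    intro t ht i hi
    rw [hGt t ht]
    exact le_sup' (fun i => |g i|) hi
  have hT_mem : T ∈ Icc 1 T := mem_Icc.mpr ⟨hT, le_rfl⟩
  have hgG : ∀ t ∈ Icc 1 T, |g t| ≤ G := fun t ht => hG ▸ hGt_ge T hT_mem t ht
  have hGpos : 0 < G := by
    obtain ⟨t, ht, hgt⟩ := hgne
    exact (abs_pos.mpr hgt).trans_le (hgG t ht)
  have hGt_nonneg : ∀ t ∈ Icc 1 T, 0 ≤ Gt t := fun t ht =>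
    (abs_nonneg _).trans (hGt_ge t ht t (mem_Icc.mpr ⟨(mem_Icc.mp ht).1, le_rfl⟩))
  have hGt_le : ∀ t ∈ Icc 1 T, Gt t ≤ G := by
    intro t ht
    rw [hGt t ht]
    exact sup'_le _ _ fun i hi => hgG i (Icc_subset_Icc_right (mem_Icc.mp ht).2 hi)
  have hratio : ∀ t ∈ Icc 1 T, 0 ≤ ((∑ i ∈ Icc 1 t, |g i|) / Gt t) ^ p := fun t ht =>
    Real.rpow_nonneg (div_nonneg (sum_nonneg fun _ _ => abs_nonneg _) (hGt_nonneg t ht)) _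
  have hM_ge : ∀ t ∈ Icc 1 T, ((∑ i ∈ Icc 1 t, |g i|) / Gt t) ^ p ≤ M := fun t ht =>
    le_sup' (fun t => ((∑ i ∈ Icc 1 t, |g i|) / Gt t) ^ p) ht
  have hM : 0 ≤ M := (hratio T hT_mem).trans (hM_ge T hT_mem)
  have hB_bounds : ∀ t ∈ Icc 1 T, 0 ≤ B t ∧ B t ≤ k * M := by
    intro t ht
    obtain ⟨ht₁, ht₂⟩ := mem_Icc.mp ht
    obtain rfl | ⟨n, rfl, hn⟩ : t = 1 ∨ ∃ n, t = n + 1 ∧ n ∈ Icc 1 T := by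
      rcases eq_or_lt_of_le ht₁ with h₁ | h₁
      · exact Or.inl h₁.symm
      · exact Or.inr ⟨t - 1, by omega, mem_Icc.mpr ⟨by omega, by omega⟩⟩
    · rw [hB1]
      exact ⟨le_rfl, by positivity⟩
    · rw [hB n hn]
      exact ⟨mul_nonneg hk.le (hratio n hn), mul_le_mul_of_nonneg_left (hM_ge n hn) hk.le⟩
  have hh_bounds : ∀ n ≤ T, 𝔤 ≤ h (n + 1) ∧ h (n + 1) ≤ 𝔤 + G := by
    intro n
    induction n with
    | zero => intro _; simp [hh1, hGpos.le]
    | succ n ih =>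
      intro hn
      have hmem : n + 1 ∈ Icc 1 T := mem_Icc.mpr ⟨by omega, hn⟩
      obtain ⟨h₁, h₂⟩ := ih (by omega)
      rw [hh _ hmem]
      exact ⟨le_max_of_le_left h₁, max_le h₂ (by linarith [hgG _ hmem])⟩
  have hh_pos : ∀ t ∈ Icc 1 T, 0 < h t := by
    intro t ht
    obtain ⟨ht₁, ht₂⟩ := mem_Icc.mp ht
    have := (hh_bounds (t - 1) (by omega)).1
    rw [Nat.sub_add_cancel ht₁] at this
    linarith
  have htrunc_le : ∀ t ∈ Icc 1 T, |gtrunc t| ≤ |g t| := by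
    intro t ht
    rw [htrunc t ht]
    exact abs_truncation_le (hh_pos t ht) _
  have hdiff : ∀ t ∈ Icc 1 T, |g t - gtrunc t| ≤ h (t + 1) - h t := by
    intro t ht
    rw [htrunc t ht, hh t ht]
    exact abs_sub_truncation_le (hh_pos t ht) _
  have hstep : ∀ t ∈ Icc 1 T, g t * (max (-(B t)) (min (w t) (B t)) - wc) ≤
      2 * (gmod t * (w t - wc)) + |gtrunc t| * max 0 (|wc| - B t) +
        (h (t + 1) - h t) * (k * M + |wc|) := by
    intro t ht
    obtain ⟨hB₀, hB₁⟩ := hB_bounds t ht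
    have h₁ := hsubgrad t ht wc
    have h₂ := mul_clamp_le hB₀ (gtrunc t) (w t)
    have h₃ : (g t - gtrunc t) * (max (-(B t)) (min (w t) (B t)) - wc) ≤
        (h (t + 1) - h t) * (k * M + |wc|) := by
      refine (le_abs_self _).trans ?_
      rw [abs_mul]
      refine mul_le_mul (hdiff t ht) ?_ (abs_nonneg _) ((abs_nonneg _).trans (hdiff t ht))
      linarith [abs_sub (max (-(B t)) (min (w t) (B t))) wc, abs_clamp_le hB₀ (w t)]
    linarith
  have htel : ∑ t ∈ Icc 1 T, (h (t + 1) - h t) ≤ G := by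
    rw [← Finset.Ico_add_one_right_eq_Icc, Finset.sum_Ico_sub h (by omega), hh1]
    linarith [(hh_bounds T le_rfl).2]
  have hpenalty := sum_mul_max_sub_le (a := fun t => |gtrunc t|) (B := B) (c := |wc|)
    (M := G * (|wc| / k) ^ ((1 - q) / p) * ((∑ t ∈ Icc 1 T, |g t|) / G) ^ q) (G := G) (T := T)
    (abs_nonneg _) (by positivity) hGpos.le (fun _ _ => abs_nonneg _)
    (fun t ht => (htrunc_le t ht).trans (hgG t ht)) (fun t ht => (hB_bounds t ht).1) (by
      intro n hn hBn
      rcases Nat.eq_zero_or_pos n with rfl | hn₀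
      · simpa using by positivity
      have hmem : n ∈ Icc 1 T := mem_Icc.mpr ⟨hn₀, hn.le⟩
      have hle : ∑ t ∈ Icc 1 n, |gtrunc t| ≤ ∑ t ∈ Icc 1 n, |g t| :=
        sum_le_sum fun t ht => htrunc_le t (Icc_subset_Icc_right hn.le ht)
      refine hle.trans ?_
      rcases (hGt_nonneg n hmem).eq_or_lt with h₀ | h₀
      · rw [sum_eq_zero fun t ht =>
          le_antisymm ((hGt_ge n hmem t ht).trans_eq h₀.symm) (abs_nonneg _)]
        positivity
      · rw [hB n hmem] at hBn
        exact le_of_mul_div_rpow_le hk hp hq₀ hq₁ (sum_nonneg fun _ _ => abs_nonneg _) h₀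
          (sum_le_sum_of_subset_of_nonneg (Icc_subset_Icc_right hn.le)
            fun _ _ _ => abs_nonneg _) (hGt_le n hmem) hBn)
  have hpow : |wc| ^ (1 + (1 - q) / p) / k ^ ((1 - q) / p) =
      |wc| * (|wc| / k) ^ ((1 - q) / p) := by
    have he : 0 ≤ (1 - q) / p := div_nonneg (by linarith) hp.le
    rw [Real.rpow_add' (abs_nonneg _) (by linarith), Real.rpow_one,
      Real.div_rpow (abs_nonneg _) hk.le, mul_div_assoc]
  have hsum := sum_le_sum hstep
  rw [sum_add_distrib, sum_add_distrib, ← mul_sum, ← sum_mul] at hsum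
  have hlast := mul_le_mul_of_nonneg_right htel (by positivity : 0 ≤ k * M + |wc|)
  rw [hpow]
  linarith
end

section
/- Let T ≥ 1, τ > 0, β > 0, and z_1,...,z_T ∈ ℝ. Let S_1 ⊇ S_2 ⊇ ... ⊇ S_T be nested closed intervals in ℝ with 0 ∈ S_1. Define A_t = τ + Σ_{i=1}^t z_i², v_1 = 0, and v_{t+1} = Π_{S_{t+1}}(v_t − z_t/(β A_t)) for t = 1,...,T−1, where Π_S denotes metric projection onto the interval S (i.e. clamping to its endpoints). Then for every v̄ ∈ S_T: Σ_{t=1}^T ( z_t(v_t − v̄) − (β/2)·(z_t(v_t − v̄))² ) ≤ (βτ/2)·v̄² + (2/β)·Σ_{t=1}^T z_t²/A_t. -/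
/-- Clamping to an interval does not increase the distance to a point of the interval. -/
theorem sq_clamp_sub_le {a b c : ℝ} (hc : c ∈ Set.Icc a b) (x : ℝ) :
    (max a (min x b) - c) ^ 2 ≤ (x - c) ^ 2 := by
  obtain ⟨hac, hcb⟩ := hc
  rcases le_total x b with hxb | hxb
  · rw [min_eq_left hxb]
    rcases le_total a x with hax | hax
    · rw [max_eq_right hax]
    · rw [max_eq_left hax]
      nlinarith
  · rw [min_eq_right hxb, max_eq_right (hac.trans hcb)]
    nlinarith

/-- The one-step inequality of the online Newton step, where `d` is the distance to the
comparator and `B` is the accumulated curvature before the step. -/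
theorem newton_step_le {β B z : ℝ} (hβ : 0 < β) (hB : 0 < B) (d : ℝ) :
    z * d - β / 2 * (z * d) ^ 2 + β * (B + z ^ 2) / 2 * (d - z / (β * (B + z ^ 2))) ^ 2 ≤
      β * B / 2 * d ^ 2 + 2 / β * (z ^ 2 / (B + z ^ 2)) := by
  have hA : 0 < B + z ^ 2 := by positivity
  have key : β * B / 2 * d ^ 2 + 2 / β * (z ^ 2 / (B + z ^ 2)) -
      (z * d - β / 2 * (z * d) ^ 2 +
        β * (B + z ^ 2) / 2 * (d - z / (β * (B + z ^ 2))) ^ 2) =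
      3 / 2 * (z ^ 2 / (β * (B + z ^ 2))) := by
    field_simp
    ring
  have : 0 ≤ 3 / 2 * (z ^ 2 / (β * (B + z ^ 2))) := by positivity
  linarith

open Finset in
/-- 1D ONS with shrinking domains (Algorithm 4 / Theorem 4).
The nested closed intervals are `S t = Set.Icc (a t) (b t)`, metric projection onto such an
interval is clamping `max (a (t+1)) (min x (b (t+1)))`, and `vbar` plays the role of v̄. -/
theorem stmt_3 (T : ℕ) (hT : 1 ≤ T) (τ β : ℝ) (hτ : 0 < τ) (hβ : 0 < β)
    (z v a b A : ℕ → ℝ)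
    (hnest : ∀ t, 1 ≤ t → t < T → Set.Icc (a (t + 1)) (b (t + 1)) ⊆ Set.Icc (a t) (b t))
    (h0S1 : (0 : ℝ) ∈ Set.Icc (a 1) (b 1))
    (hA : ∀ t ∈ Icc 1 T, A t = τ + ∑ i ∈ Icc 1 t, (z i) ^ 2)
    (hv1 : v 1 = 0)
    (hvrec : ∀ t, 1 ≤ t → t < T →
      v (t + 1) = max (a (t + 1)) (min (v t - z t / (β * A t)) (b (t + 1)))) :
    ∀ vbar ∈ Set.Icc (a T) (b T),
      ∑ t ∈ Icc 1 T, (z t * (v t - vbar) - β / 2 * (z t * (v t - vbar)) ^ 2) ≤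
        β * τ / 2 * vbar ^ 2 + 2 / β * ∑ t ∈ Icc 1 T, (z t) ^ 2 / A t := by
  intro vbar hvbar
  have hmem : ∀ t, t ≤ T → 1 ≤ t → vbar ∈ Set.Icc (a t) (b t) := by
    intro t ht
    induction ht using Nat.decreasingInduction with
    | self => exact fun _ => hvbar
    | of_succ k hk ih => exact fun h1 => hnest k h1 hk (ih (by omega))
  have hpos : ∀ n, 0 < τ + ∑ i ∈ Icc 1 n, (z i) ^ 2 := fun n =>
    add_pos_of_pos_of_nonneg hτ (Finset.sum_nonneg fun i _ => sq_nonneg (z i))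
  have hstep : ∀ n, n < T →
      z (n + 1) * (v (n + 1) - vbar) - β / 2 * (z (n + 1) * (v (n + 1) - vbar)) ^ 2 +
        β * A (n + 1) / 2 * (v (n + 1) - vbar - z (n + 1) / (β * A (n + 1))) ^ 2 ≤
      β * (τ + ∑ i ∈ Icc 1 n, (z i) ^ 2) / 2 * (v (n + 1) - vbar) ^ 2 +
        2 / β * ((z (n + 1)) ^ 2 / A (n + 1)) := by
    intro n hn
    rw [hA (n + 1) (Finset.mem_Icc.2 ⟨by omega, hn⟩),
      Finset.sum_Icc_succ_top (by omega : 1 ≤ n + 1), ← add_assoc]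
    exact newton_step_le hβ (hpos n) _
  have hpartial : ∀ n, n < T →
      ∑ t ∈ Icc 1 n, (z t * (v t - vbar) - β / 2 * (z t * (v t - vbar)) ^ 2) +
        β * (τ + ∑ i ∈ Icc 1 n, (z i) ^ 2) / 2 * (v (n + 1) - vbar) ^ 2 ≤
      β * τ / 2 * vbar ^ 2 + 2 / β * ∑ t ∈ Icc 1 n, (z t) ^ 2 / A t := by
    intro n
    induction n with
    | zero => simp [hv1]
    | succ n ih =>
      intro hn
      have hproj : (v (n + 1 + 1) - vbar) ^ 2 ≤
          (v (n + 1) - vbar - z (n + 1) / (β * A (n + 1))) ^ 2 := by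
        rw [hvrec (n + 1) (by omega) hn, sub_right_comm]
        exact sq_clamp_sub_le (hmem _ hn (by omega)) _
      have hAn := hA (n + 1) (Finset.mem_Icc.2 ⟨by omega, hn.le⟩)
      have hApos : 0 < A (n + 1) := hAn ▸ hpos (n + 1)
      have hmul := mul_le_mul_of_nonneg_left hproj
        (by positivity : 0 ≤ β * A (n + 1) / 2)
      rw [← hAn, Finset.sum_Icc_succ_top (by omega : 1 ≤ n + 1),
        Finset.sum_Icc_succ_top (by omega : 1 ≤ n + 1), mul_add]
      linarith [ih (by omega), hstep n (by omega)]
  obtain ⟨n, rfl⟩ : ∃ n, T = n + 1 := ⟨T - 1, by omega⟩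
  have hAn := hA (n + 1) (Finset.mem_Icc.2 ⟨by omega, le_rfl⟩)
  have hApos : 0 < A (n + 1) := hAn ▸ hpos (n + 1)
  have hlast : 0 ≤ β * A (n + 1) / 2 *
      (v (n + 1) - vbar - z (n + 1) / (β * A (n + 1))) ^ 2 := by positivity
  rw [Finset.sum_Icc_succ_top (by omega : 1 ≤ n + 1),
    Finset.sum_Icc_succ_top (by omega : 1 ≤ n + 1), mul_add]
  linarith [hpartial n (by omega), hstep n (by omega)]
end

section
/- For every real x with −1 < x ≤ 2: ln(1 + x) ≤ x − ((2 − ln 3)/4)·x². -/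
theorem hasDerivAt_quadratic_sub_log (c : ℝ) {x : ℝ} (hx : -1 < x) :
    HasDerivAt (fun y : ℝ => y - c * y ^ 2 - Real.log (1 + y))
      (x * (1 - 2 * c * (1 + x)) / (1 + x)) x := by
  have hx' : 1 + x ≠ 0 := by linarith
  have h := ((hasDerivAt_id' x).sub (((hasDerivAt_id' x).pow 2).const_mul c)).sub
    (((hasDerivAt_id' x).const_add 1).log hx')
  refine h.congr_deriv ?_
  field_simp
  ring

theorem monotoneOn_quadratic_sub_log (c : ℝ) {a b : ℝ} (ha : -1 < a)
    (h : ∀ x ∈ Set.Ioo a b, 0 ≤ x * (1 - 2 * c * (1 + x))) :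
    MonotoneOn (fun y : ℝ => y - c * y ^ 2 - Real.log (1 + y)) (Set.Icc a b) := by
  refine monotoneOn_of_hasDerivWithinAt_nonneg (convex_Icc a b)
    (fun x hx => (hasDerivAt_quadratic_sub_log c (ha.trans_le hx.1)).continuousAt.continuousWithinAt)
    (fun x hx => (hasDerivAt_quadratic_sub_log c
      (ha.trans_le (interior_subset hx).1)).hasDerivWithinAt) fun x hx => ?_
  rw [interior_Icc] at hx
  exact div_nonneg (h x hx) (by linarith [hx.1])

theorem antitoneOn_quadratic_sub_log (c : ℝ) {a b : ℝ} (ha : -1 < a)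
    (h : ∀ x ∈ Set.Ioo a b, x * (1 - 2 * c * (1 + x)) ≤ 0) :
    AntitoneOn (fun y : ℝ => y - c * y ^ 2 - Real.log (1 + y)) (Set.Icc a b) := by
  refine antitoneOn_of_hasDerivWithinAt_nonpos (convex_Icc a b)
    (fun x hx => (hasDerivAt_quadratic_sub_log c (ha.trans_le hx.1)).continuousAt.continuousWithinAt)
    (fun x hx => (hasDerivAt_quadratic_sub_log c
      (ha.trans_le (interior_subset hx).1)).hasDerivWithinAt) fun x hx => ?_
  rw [interior_Icc] at hx
  exact div_nonpos_of_nonpos_of_nonneg (h x hx) (by linarith [hx.1])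

/-- for −1 < x ≤ 2, ln(1 + x) ≤ x − ((2 − ln 3)/4)·x². -/
theorem stmt_5 (x : ℝ) (hx1 : -1 < x) (hx2 : x ≤ 2) :
    Real.log (1 + x) ≤ x - (2 - Real.log 3) / 4 * x ^ 2 := by
  have hlog_pos : 0 < Real.log 3 := Real.log_pos (by norm_num)
  have hlog_lt : Real.log 3 < 3 - 1 := Real.log_lt_sub_one_of_pos (by norm_num) (by norm_num)
  obtain ⟨c, hc⟩ : ∃ c, c = (2 - Real.log 3) / 4 := ⟨_, rfl⟩
  have hc0 : 0 < c := by linarith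
  have hc1 : c < 1 / 2 := by linarith
  rw [← hc, ← sub_nonneg]
  rcases le_total x 0 with h0 | h0
  · have hanti := antitoneOn_quadratic_sub_log c (b := 0) hx1 fun y hy =>
      mul_nonpos_of_nonpos_of_nonneg hy.2.le (by nlinarith [hy.2])
    simpa using hanti ⟨le_rfl, h0⟩ ⟨h0, le_rfl⟩ h0
  rcases le_total (2 * c * (1 + x)) 1 with hm | hm
  · have hmono := monotoneOn_quadratic_sub_log c (a := 0) (b := x) (by norm_num) fun y hy =>
      mul_nonneg hy.1.le (by nlinarith [hy.2])
    simpa using hmono ⟨le_rfl, h0⟩ ⟨h0, le_rfl⟩ h0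
  · have hanti := antitoneOn_quadratic_sub_log c (b := 2) hx1 fun y hy =>
      mul_nonpos_of_nonneg_of_nonpos (h0.trans hy.1.le) (by nlinarith [hy.1])
    have h2 := hanti ⟨le_rfl, hx2⟩ ⟨hx2, le_rfl⟩ hx2
    norm_num at h2 ⊢
    linarith
end

section
/- Let G > 0 and let g, v, v̄ be reals with |g| ≤ G, |v| ≤ 1/(2G), and |v̄| ≤ 1/(2G). Define ℓ(u) = −ln(1 − g·u). Then, writing ℓ'(v) = g/(1 − g·v), we have: ℓ(v) − ℓ(v̄) ≤ ℓ'(v)·(v − v̄) − ((2 − ln 3)/4)·(ℓ'(v)·(v − v̄))². -/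
/-- The function `z ↦ z - c * z ^ 2 - log (1 + z)` and its derivative on `(-1, ∞)`. -/
theorem hasDerivAt_sub_sq_sub_log (c : ℝ) {z : ℝ} (hz : -1 < z) :
    HasDerivAt (fun z : ℝ => z - c * z ^ 2 - Real.log (1 + z))
      (z * (1 - 2 * c * (1 + z)) / (1 + z)) z := by
  have h1 : (1 + z) ≠ 0 := by linarith
  have h := ((hasDerivAt_id z).sub (((hasDerivAt_id z).pow 2).const_mul c)).sub
    (((hasDerivAt_id z).const_add 1).log h1)
  refine h.congr_deriv ?_
  norm_num [id]
  field_simp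
  ring

/-- A quadratic upper bound for `log (1 + z)`, with equality at `z = 0` and `z = 2`. -/
theorem log_one_add_le_sub_mul_sq {z : ℝ} (hz : -1 < z) (hz2 : z ≤ 2) :
    Real.log (1 + z) ≤ z - (2 - Real.log 3) / 4 * z ^ 2 := by
  set c : ℝ := (2 - Real.log 3) / 4 with hc
  have hc0 : 0 < c := by
    have := Real.log_lt_sub_one_of_pos (show (0 : ℝ) < 3 by norm_num) (by norm_num)
    linarith
  have hc1 : 2 * c ≤ 1 := by
    have := Real.log_nonneg (show (1 : ℝ) ≤ 3 by norm_num)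
    linarith
  set f : ℝ → ℝ := fun z => z - c * z ^ 2 - Real.log (1 + z) with hf
  have hd : ∀ x, -1 < x → HasDerivAt f (x * (1 - 2 * c * (1 + x)) / (1 + x)) x :=
    fun x hx => hasDerivAt_sub_sq_sub_log c hx
  have f0 : f 0 = 0 := by simp [hf]
  have f2 : f 2 = 0 := by
    simp only [hf, hc]
    norm_num
  suffices 0 ≤ f z by simp only [hf] at this; linarith
  rcases le_total z 0 with h0 | h0
  · have hanti : AntitoneOn f (Set.Icc z 0) := by
      refine antitoneOn_of_hasDerivWithinAt_nonpos (convex_Icc _ _)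
        (fun x hx => (hd x (by linarith [hx.1])).continuousAt.continuousWithinAt)
        (fun x hx => (hd x ?_).hasDerivWithinAt) (fun x hx => ?_) <;>
        rw [interior_Icc] at hx <;> obtain ⟨h1, h2⟩ := hx
      · linarith
      · exact div_nonpos_of_nonpos_of_nonneg
          (mul_nonpos_of_nonpos_of_nonneg h2.le (by nlinarith)) (by linarith)
    rw [← f0]
    exact hanti ⟨le_rfl, h0⟩ ⟨h0, le_rfl⟩ h0
  · rcases le_total (2 * c * (1 + z)) 1 with h | h
    · have hmono : MonotoneOn f (Set.Icc 0 z) := by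
        refine monotoneOn_of_hasDerivWithinAt_nonneg (convex_Icc _ _)
          (fun x hx => (hd x (by linarith [hx.1])).continuousAt.continuousWithinAt)
          (fun x hx => (hd x ?_).hasDerivWithinAt) (fun x hx => ?_) <;>
          rw [interior_Icc] at hx <;> obtain ⟨h1, h2⟩ := hx
        · linarith
        · exact div_nonneg (mul_nonneg h1.le (by nlinarith)) (by linarith)
      rw [← f0]
      exact hmono ⟨le_rfl, h0⟩ ⟨h0, le_rfl⟩ h0
    · have hanti : AntitoneOn f (Set.Icc z 2) := by
        refine antitoneOn_of_hasDerivWithinAt_nonpos (convex_Icc _ _)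
          (fun x hx => (hd x (by linarith [hx.1])).continuousAt.continuousWithinAt)
          (fun x hx => (hd x ?_).hasDerivWithinAt) (fun x hx => ?_) <;>
          rw [interior_Icc] at hx <;> obtain ⟨h1, h2⟩ := hx
        · linarith
        · exact div_nonpos_of_nonpos_of_nonneg
            (mul_nonpos_of_nonneg_of_nonpos (by linarith) (by nlinarith)) (by linarith)
      rw [← f2]
      exact hanti ⟨le_rfl, hz2⟩ ⟨hz2, le_rfl⟩ hz2

/-- If `|g| ≤ G` and `|u| ≤ 1 / (2 * G)` then `|g * u| ≤ 1 / 2`. -/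
theorem abs_mul_le_half {G g u : ℝ} (hG : 0 < G) (hg : |g| ≤ G) (hu : |u| ≤ 1 / (2 * G)) :
    |g * u| ≤ 1 / 2 := by
  rw [abs_mul]
  calc |g| * |u| ≤ G * (1 / (2 * G)) := by gcongr
    _ = 1 / 2 := by field_simp

/-- exp-concavity type inequality for the coin-betting loss ℓ(u) = −ln(1 − g·u).
Here `vbar` plays the role of v̄. -/
theorem stmt_6 (G g v vbar : ℝ) (hG : 0 < G) (hg : |g| ≤ G)
    (hv : |v| ≤ 1 / (2 * G)) (hvbar : |vbar| ≤ 1 / (2 * G)) :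
    (-Real.log (1 - g * v)) - (-Real.log (1 - g * vbar)) ≤
      (g / (1 - g * v)) * (v - vbar) -
        (2 - Real.log 3) / 4 * ((g / (1 - g * v)) * (v - vbar)) ^ 2 := by
  obtain ⟨ha1, ha2⟩ := abs_le.mp (abs_mul_le_half hG hg hv)
  obtain ⟨hb1, hb2⟩ := abs_le.mp (abs_mul_le_half hG hg hvbar)
  have ha : 0 < 1 - g * v := by linarith
  have hb : 0 < 1 - g * vbar := by linarith
  have hz : 1 + g / (1 - g * v) * (v - vbar) = (1 - g * vbar) / (1 - g * v) := by
    field_simp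
    ring
  have hpos : 0 < (1 - g * vbar) / (1 - g * v) := div_pos hb ha
  have hle : (1 - g * vbar) / (1 - g * v) ≤ 3 := by
    rw [div_le_iff₀ ha]
    linarith
  have key := log_one_add_le_sub_mul_sq (z := g / (1 - g * v) * (v - vbar))
    (by linarith) (by linarith)
  rw [hz, Real.log_div hb.ne' ha.ne'] at key
  linarith
end

section
/- Let T ≥ 1, α > 0, let h_1 ≤ ... ≤ h_{T+1} be positive reals (with h_{T+1} = h_T allowed), and let g_1,...,g_T be reals with |g_t| ≤ h_t. Set β = (2 − ln 3)/2 and define the losses ℓ_t(v) = −ln(1 − g_t·v). Define v_1 = 0, z_t = g_t/(1 − g_t v_t), A_t = 4α + Σ_{i=1}^t z_i², and v_{t+1} = clamp(v_t − z_t/(β A_t), [−1/(2h_{t+1}), 1/(2h_{t+1})]). Then for every v̄ with |v̄| ≤ 1/(2h_T): Σ_{t=1}^T (ℓ_t(v_t) − ℓ_t(v̄)) ≤ α/(4h_T²) + 4.5·ln((α + Σ_{t=1}^T g_t²)/α). -/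
/-- A quadratic strengthening of `log (1 - x) ≤ -x`, tight at `x = -2` for
`β = (2 - log 3) / 2`. -/
theorem log_one_sub_le_neg_sub_sq {β x : ℝ} (hβ : β = (2 - Real.log 3) / 2)
    (hβ0 : 0 < β) (hβ1 : β ≤ 1) (hx : -2 ≤ x) (hx1 : x < 1) :
    Real.log (1 - x) ≤ -x - β / 2 * x ^ 2 := by
  let F : ℝ → ℝ := fun y => -y - β / 2 * y ^ 2 - Real.log (1 - y)
  have hd : ∀ y < 1, HasDerivAt F (y * (1 - β + β * y) / (1 - y)) y := by
    intro y hy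
    have hne : 1 - y ≠ 0 := by linarith
    have key := (((hasDerivAt_id y).neg).sub (((hasDerivAt_id y).pow 2).const_mul (β / 2))).sub
      (((hasDerivAt_id y).const_sub 1).log hne)
    refine key.congr_deriv ?_
    simp only [id]
    field_simp
    norm_num
    ring
  have hc : ∀ s : Set ℝ, (∀ y ∈ s, y < 1) → ContinuousOn F s := fun s hs y hy =>
    (hd y (hs y hy)).continuousAt.continuousWithinAt
  suffices 0 ≤ F x by simp only [F] at this; linarith
  have hF0 : F 0 = 0 := by simp [F]
  rcases le_total 0 x with h0 | h0
  · have hmono : MonotoneOn F (Set.Ico 0 1) := by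
      refine monotoneOn_of_deriv_nonneg (convex_Ico 0 1) (hc _ fun y hy => hy.2) ?_ ?_
      · intro y hy
        rw [interior_Ico] at hy
        exact (hd y hy.2).differentiableAt.differentiableWithinAt
      · intro y hy
        rw [interior_Ico] at hy
        rw [(hd y hy.2).deriv]
        have h1 := mul_pos hβ0 hy.1
        exact div_nonneg (mul_nonneg hy.1.le (by linarith)) (by linarith [hy.2])
    have := hmono ⟨le_rfl, one_pos⟩ ⟨h0, hx1⟩ h0
    linarith
  · rcases le_total 0 (1 - β + β * x) with hs | hs
    · have hanti : AntitoneOn F (Set.Icc x 0) := by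
        refine antitoneOn_of_deriv_nonpos (convex_Icc x 0)
          (hc _ fun y hy => by linarith [hy.2]) ?_ ?_
        · intro y hy
          rw [interior_Icc] at hy
          exact (hd y (by linarith [hy.2])).differentiableAt.differentiableWithinAt
        · intro y hy
          rw [interior_Icc] at hy
          rw [(hd y (by linarith [hy.2])).deriv]
          have h1 := mul_le_mul_of_nonneg_left hy.1.le hβ0.le
          exact div_nonpos_of_nonpos_of_nonneg
            (mul_nonpos_of_nonpos_of_nonneg hy.2.le (by linarith)) (by linarith [hy.2])
      have := hanti ⟨le_rfl, h0⟩ ⟨h0, le_rfl⟩ h0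
      linarith
    · have hmono : MonotoneOn F (Set.Icc (-2) x) := by
        refine monotoneOn_of_deriv_nonneg (convex_Icc (-2) x)
          (hc _ fun y hy => by linarith [hy.2]) ?_ ?_
        · intro y hy
          rw [interior_Icc] at hy
          exact (hd y (by linarith [hy.2])).differentiableAt.differentiableWithinAt
        · intro y hy
          rw [interior_Icc] at hy
          rw [(hd y (by linarith [hy.2])).deriv]
          have h1 := mul_le_mul_of_nonneg_left hy.2.le hβ0.le
          exact div_nonneg (mul_nonneg_of_nonpos_of_nonpos (by linarith [hy.2]) (by linarith))
            (by linarith [hy.2])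
      have := hmono ⟨le_rfl, hx⟩ ⟨hx, le_rfl⟩ hx
      have hF2 : F (-2) = 0 := by
        simp only [F, hβ]
        norm_num
        ring
      linarith

theorem log_three_lt_three_halves : Real.log 3 < 3 / 2 := by
  have h4 : Real.log 4 = 2 * Real.log 2 := by
    rw [show (4 : ℝ) = 2 ^ 2 by norm_num, Real.log_pow]
    norm_num
  have h34 : Real.log 3 < Real.log 4 := Real.log_lt_log (by norm_num) (by norm_num)
  linarith [Real.log_two_lt_d9]

theorem one_lt_log_three : 1 < Real.log 3 := by
  rw [Real.lt_log_iff_exp_lt (by norm_num)]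
  linarith [Real.exp_one_lt_d9]

/-- Clamping to a symmetric interval does not increase the distance to its points. -/
theorem sq_clamp_sub_le_s7 {r w u : ℝ} (hu : |u| ≤ r) :
    (max (-r) (min w r) - u) ^ 2 ≤ (w - u) ^ 2 := by
  obtain ⟨h1, h2⟩ := abs_le.mp hu
  rw [sq_le_sq]
  rcases le_total w r with hw | hw
  · rw [min_eq_left hw]
    rcases le_total (-r) w with hw' | hw'
    · rw [max_eq_right hw']
    · rw [max_eq_left hw', abs_of_nonpos (by linarith), abs_of_nonpos (by linarith)]
      linarith
  · rw [min_eq_right hw, max_eq_right (by linarith), abs_of_nonneg (by linarith),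
      abs_of_nonneg (by linarith)]
    linarith

theorem abs_clamp_le_s7 {r w : ℝ} (hr : 0 ≤ r) : |max (-r) (min w r)| ≤ r :=
  abs_le.mpr ⟨le_max_left _ _, max_le (by linarith) (min_le_right _ _)⟩

theorem abs_mul_le_half_s7 {g h v : ℝ} (hh : 0 < h) (hg : |g| ≤ h) (hv : |v| ≤ 1 / (2 * h)) :
    |g * v| ≤ 1 / 2 := by
  rw [abs_mul]
  calc |g| * |v| ≤ h * (1 / (2 * h)) := mul_le_mul hg hv (abs_nonneg _) hh.le
    _ = 1 / 2 := by field_simp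

/-- One step of Online Newton Step on a coin-betting loss. -/
theorem coin_betting_newton_step {β B g v u z : ℝ} (hβ : β = (2 - Real.log 3) / 2)
    (hβ0 : 0 < β) (hβ1 : β ≤ 1) (hB : 0 < B) (hv : |g * v| ≤ 1 / 2) (hu : |g * u| ≤ 1 / 2)
    (hz : z = g / (1 - g * v)) :
    ((-Real.log (1 - g * v)) - (-Real.log (1 - g * u))) +
        β / 2 * (B + z ^ 2) * (v - z / (β * (B + z ^ 2)) - u) ^ 2 ≤
      β / 2 * B * (v - u) ^ 2 + 1 / (2 * β) * (Real.log (B + z ^ 2) - Real.log B) := by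
  obtain ⟨hv1, hv2⟩ := abs_le.mp hv
  obtain ⟨hu1, hu2⟩ := abs_le.mp hu
  have hpv : 0 < 1 - g * v := by linarith
  have hpu : 0 < 1 - g * u := by linarith
  have hA : 0 < B + z ^ 2 := by positivity
  have hratio : 1 - z * (u - v) = (1 - g * u) / (1 - g * v) := by
    rw [hz]; field_simp; ring
  have hpos : 0 < (1 - g * u) / (1 - g * v) := div_pos hpu hpv
  have hle : (1 - g * u) / (1 - g * v) ≤ 3 := by
    rw [div_le_iff₀ hpv]; linarith
  have hlog := log_one_sub_le_neg_sub_sq (x := z * (u - v)) hβ hβ0 hβ1 (by linarith)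
    (by linarith)
  rw [hratio, Real.log_div hpu.ne' hpv.ne'] at hlog
  have hdet : z ^ 2 / (B + z ^ 2) ≤ Real.log (B + z ^ 2) - Real.log B := by
    have := Real.one_sub_inv_le_log_of_pos (div_pos hA hB)
    rw [Real.log_div hA.ne' hB.ne', inv_div] at this
    have e : z ^ 2 / (B + z ^ 2) = 1 - B / (B + z ^ 2) := by field_simp; ring
    linarith
  have hdet' := mul_le_mul_of_nonneg_left hdet (show 0 ≤ 1 / (2 * β) by positivity)
  have hsq : β / 2 * (B + z ^ 2) * (v - z / (β * (B + z ^ 2)) - u) ^ 2 =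
      β / 2 * (B + z ^ 2) * (v - u) ^ 2 - z * (v - u) +
        1 / (2 * β) * (z ^ 2 / (B + z ^ 2)) := by
    field_simp
    ring
  rw [hsq]
  linarith


open Finset in
/-- regret of ONS with shrinking domains [−1/(2h_t), 1/(2h_t)] on the coin-betting
losses ℓ_t(v) = −ln(1 − g_t·v) (Lemma 4 in the appendix). Here β = (2 − ln 3)/2, the update is
v_{t+1} = clamp(v_t − z_t/(β A_t), [−1/(2h_{t+1}), 1/(2h_{t+1})]), and `vbar` is v̄. -/
theorem stmt_7 (T : ℕ) (hT : 1 ≤ T) (α : ℝ) (hα : 0 < α)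
    (h g v z A : ℕ → ℝ)
    (hhpos : ∀ t ∈ Icc 1 (T + 1), 0 < h t)
    (hhmono : ∀ t ∈ Icc 1 T, h t ≤ h (t + 1))
    (hgh : ∀ t ∈ Icc 1 T, |g t| ≤ h t)
    (hv1 : v 1 = 0)
    (hz : ∀ t ∈ Icc 1 T, z t = g t / (1 - g t * v t))
    (hA : ∀ t ∈ Icc 1 T, A t = 4 * α + ∑ i ∈ Icc 1 t, (z i) ^ 2)
    (hvrec : ∀ t ∈ Icc 1 T,
      v (t + 1) = max (-(1 / (2 * h (t + 1))))
        (min (v t - z t / ((2 - Real.log 3) / 2 * A t)) (1 / (2 * h (t + 1))))) :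
    ∀ vbar : ℝ, |vbar| ≤ 1 / (2 * h T) →
      ∑ t ∈ Icc 1 T, ((-Real.log (1 - g t * v t)) - (-Real.log (1 - g t * vbar))) ≤
        α / (4 * (h T) ^ 2) + 4.5 * Real.log ((α + ∑ t ∈ Icc 1 T, (g t) ^ 2) / α) := by
  intro u hu
  obtain ⟨β, hβ⟩ : ∃ β : ℝ, β = (2 - Real.log 3) / 2 := ⟨_, rfl⟩
  have hβ4 : 1 / 4 < β := by linarith [log_three_lt_three_halves]
  have hβ2 : β < 1 / 2 := by linarith [one_lt_log_three]
  have hβ0 : 0 < β := by linarith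
  rw [← hβ] at hvrec
  have hmono : ∀ n ≤ T, ∀ m, 1 ≤ m → m ≤ n → h m ≤ h n := by
    intro n hn m hm hmn
    induction n, hmn using Nat.le_induction with
    | base => exact le_rfl
    | succ n hmn ih =>
      exact (ih (by omega)).trans (hhmono n (mem_Icc.mpr ⟨by omega, by omega⟩))
  have hpos : ∀ t, 1 ≤ t → t ≤ T → 0 < h t := fun t h1 h2 =>
    hhpos t (mem_Icc.mpr ⟨h1, by omega⟩)
  have huv : ∀ t, 1 ≤ t → t ≤ T → |u| ≤ 1 / (2 * h t) := fun t h1 h2 =>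
    hu.trans (one_div_le_one_div_of_le (by linarith [hpos t h1 h2])
      (by linarith [hmono T le_rfl t h1 h2]))
  have hvb : ∀ t, 1 ≤ t → t ≤ T → |v t| ≤ 1 / (2 * h t) := by
    intro t h1 h2
    have hr : 0 ≤ 1 / (2 * h t) := by have := hpos t h1 h2; positivity
    obtain ⟨s, rfl⟩ := Nat.exists_eq_add_of_le' h1
    rcases Nat.eq_zero_or_pos s with rfl | hs
    · simpa [hv1] using hr
    · rw [hvrec s (mem_Icc.mpr ⟨hs, by omega⟩)]
      exact abs_clamp_le_s7 hr
  have hgv : ∀ t, 1 ≤ t → t ≤ T → |g t * v t| ≤ 1 / 2 := fun t h1 h2 =>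
    abs_mul_le_half_s7 (hpos t h1 h2) (hgh t (mem_Icc.mpr ⟨h1, h2⟩)) (hvb t h1 h2)
  let B : ℕ → ℝ := fun n => 4 * α + ∑ i ∈ Icc 1 n, (z i) ^ 2
  have hB0 : B 0 = 4 * α := by simp [B]
  have hBpos : ∀ n, 0 < B n := fun n =>
    add_pos_of_pos_of_nonneg (by linarith) (sum_nonneg fun i _ => sq_nonneg (z i))
  have hBsucc : ∀ n, B (n + 1) = B n + z (n + 1) ^ 2 := fun n => by
    simp only [B]
    rw [sum_Icc_succ_top (by omega)]
    ring
  have hstep : ∀ n < T, ((-Real.log (1 - g (n + 1) * v (n + 1))) -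
        (-Real.log (1 - g (n + 1) * u))) +
        β / 2 * B (n + 1) * (v (n + 1) - z (n + 1) / (β * B (n + 1)) - u) ^ 2 ≤
      β / 2 * B n * (v (n + 1) - u) ^ 2 +
        1 / (2 * β) * (Real.log (B (n + 1)) - Real.log (B n)) := by
    intro n hn
    have hmem : n + 1 ∈ Icc 1 T := mem_Icc.mpr ⟨by omega, hn⟩
    rw [hBsucc]
    exact coin_betting_newton_step hβ hβ0 (by linarith) (hBpos n)
      (hgv _ (by omega) hn)
      (abs_mul_le_half_s7 (hpos _ (by omega) hn) (hgh _ hmem) (huv _ (by omega) hn)) (hz _ hmem)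
  have hpot : ∀ n < T, ∑ t ∈ Icc 1 n, ((-Real.log (1 - g t * v t)) -
        (-Real.log (1 - g t * u))) + β / 2 * B n * (v (n + 1) - u) ^ 2 ≤
      β / 2 * B 0 * u ^ 2 + 1 / (2 * β) * (Real.log (B n) - Real.log (B 0)) := by
    intro n
    induction n with
    | zero => intro _; simp [hv1]
    | succ n ih =>
      intro hn
      have hclamp : (v (n + 1 + 1) - u) ^ 2 ≤
          (v (n + 1) - z (n + 1) / (β * B (n + 1)) - u) ^ 2 := by
        have hmem : n + 1 ∈ Icc 1 T := mem_Icc.mpr ⟨by omega, by omega⟩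
        rw [hvrec _ hmem, hA _ hmem]
        exact sq_clamp_sub_le_s7 (huv _ (by omega) (by omega))
      have hscaled := mul_le_mul_of_nonneg_left hclamp
        (show 0 ≤ β / 2 * B (n + 1) by have := hBpos (n + 1); positivity)
      rw [sum_Icc_succ_top (by omega)]
      linarith [ih (by omega), hstep n (by omega)]
  have hfinal : ∑ t ∈ Icc 1 T, ((-Real.log (1 - g t * v t)) - (-Real.log (1 - g t * u))) ≤
      β / 2 * B 0 * u ^ 2 + 1 / (2 * β) * (Real.log (B T) - Real.log (B 0)) := by
    obtain ⟨n, rfl⟩ := Nat.exists_eq_add_of_le' hT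
    have hnonneg : 0 ≤ β / 2 * B (n + 1) *
        (v (n + 1) - z (n + 1) / (β * B (n + 1)) - u) ^ 2 := by
      have := hBpos (n + 1)
      positivity
    rw [sum_Icc_succ_top (by omega)]
    linarith [hpot n (by omega), hstep n (by omega)]
  refine hfinal.trans (add_le_add ?_ ?_)
  · have hT0 := hpos T hT le_rfl
    have hu2 : u ^ 2 ≤ 1 / (4 * h T ^ 2) := by
      calc u ^ 2 = |u| ^ 2 := (sq_abs u).symm
        _ ≤ (1 / (2 * h T)) ^ 2 := pow_le_pow_left₀ (abs_nonneg u) hu 2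
        _ = 1 / (4 * h T ^ 2) := by field_simp; norm_num
    calc β / 2 * B 0 * u ^ 2 = 2 * β * α * u ^ 2 := by rw [hB0]; ring
      _ ≤ α * (1 / (4 * h T ^ 2)) :=
        mul_le_mul (by nlinarith) hu2 (sq_nonneg u) hα.le
      _ = α / (4 * h T ^ 2) := by ring
  · have hzg : ∀ t ∈ Icc 1 T, z t ^ 2 ≤ 4 * g t ^ 2 := by
      intro t ht
      obtain ⟨h1, h2⟩ := mem_Icc.mp ht
      have hhalf : 1 / 2 ≤ 1 - g t * v t := by linarith [(abs_le.mp (hgv t h1 h2)).2]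
      rw [hz t ht, div_pow, div_le_iff₀ (by positivity)]
      nlinarith [mul_nonneg (sq_nonneg (g t))
        (show 0 ≤ 4 * (1 - g t * v t) ^ 2 - 1 by nlinarith)]
    have hBT : B T / B 0 ≤ (α + ∑ t ∈ Icc 1 T, (g t) ^ 2) / α := by
      have hsum := sum_le_sum hzg
      rw [← mul_sum] at hsum
      rw [hB0, div_le_div_iff₀ (by linarith) hα]
      simp only [B]
      nlinarith
    have hB1 : 1 ≤ B T / B 0 := by
      rw [one_le_div (hBpos 0), hB0]
      exact le_add_of_nonneg_right (sum_nonneg fun i _ => sq_nonneg (z i))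
    rw [← Real.log_div (hBpos T).ne' (hBpos 0).ne']
    refine mul_le_mul ?_ (Real.log_le_log (by linarith) hBT) (Real.log_nonneg hB1) (by norm_num)
    rw [div_le_iff₀ (by linarith)]
    linarith
end

section
/- Let W be a real inner product space, T ≥ 1, and let g_1,...,g_T ∈ W satisfy Σ_{i=1}^t ‖g_i‖² > 0 for every t ≤ T. Define η_t = √2 / sqrt(Σ_{i=1}^t ‖g_i‖²), w_1 = 0, and w_{t+1} = u_t / max(1, ‖u_t‖) where u_t = w_t − η_t g_t (i.e. w_{t+1} is the projection of w_t − η_t g_t onto the closed unit ball). Then for every ẘ ∈ W with ‖ẘ‖ ≤ 1: Σ_{t=1}^T ⟨g_t, w_t − ẘ⟩ ≤ 2^{3/2} · sqrt(Σ_{t=1}^T ‖g_t‖²). -/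
open RealInnerProductSpace in
/-- Radial projection onto the closed unit ball does not increase the distance to a point of it. -/
lemma norm_inv_max_smul_sub_sq_le {W : Type*} [NormedAddCommGroup W] [InnerProductSpace ℝ W]
    (u c : W) (hc : ‖c‖ ≤ 1) : ‖(max 1 ‖u‖)⁻¹ • u - c‖ ^ 2 ≤ ‖u - c‖ ^ 2 := by
  rcases le_total ‖u‖ 1 with h | h
  · simp [max_eq_left h]
  · have hpos : 0 < ‖u‖ := by linarith
    have hinner : ⟪u, c⟫ ≤ ‖u‖ :=
      (real_inner_le_norm u c).trans (mul_le_of_le_one_right (norm_nonneg u) hc)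
    have hinv : ‖u‖⁻¹ * ‖u‖ = 1 := inv_mul_cancel₀ hpos.ne'
    have hinv1 : ‖u‖⁻¹ ≤ 1 := inv_le_one_of_one_le₀ h
    rw [max_eq_right h, norm_sub_sq_real, norm_sub_sq_real, norm_smul, norm_inv, norm_norm, hinv,
      real_inner_smul_left]
    nlinarith [mul_le_mul_of_nonneg_left hinner (sub_nonneg.2 hinv1), sq_nonneg (‖u‖ - 1)]

lemma norm_inv_max_smul_le_one {W : Type*} [NormedAddCommGroup W] [NormedSpace ℝ W] (u : W) :
    ‖(max 1 ‖u‖)⁻¹ • u‖ ≤ 1 := by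
  have hpos : 0 < max 1 ‖u‖ := lt_max_of_lt_left one_pos
  rw [norm_smul, norm_inv, Real.norm_of_nonneg hpos.le, inv_mul_le_one₀ hpos]
  exact le_max_right _ _

open RealInnerProductSpace in
/-- The one-step regret bound of projected gradient descent with step size `√2 / S`. -/
lemma inner_sub_le_of_projected_step {W : Type*} [NormedAddCommGroup W] [InnerProductSpace ℝ W]
    (x y g c : W) (η R S : ℝ) (hc : ‖c‖ ≤ 1) (hx : ‖x‖ ≤ 1) (hR : 0 ≤ R) (hS : 0 < S)
    (hRS : S ^ 2 = R ^ 2 + ‖g‖ ^ 2) (hη : η = √2 / S)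
    (hy : y = (max 1 ‖x - η • g‖)⁻¹ • (x - η • g)) :
    ⟪g, x - c⟫ ≤ 2 * √2 * (S - R) + √2 / 4 * (R * ‖x - c‖ ^ 2 - S * ‖y - c‖ ^ 2) := by
  have hs : √2 ^ 2 = (2 : ℝ) := Real.sq_sqrt (by norm_num)
  have hs0 : 0 < √(2 : ℝ) := by positivity
  have hRleS : R ≤ S := by nlinarith [sq_nonneg ‖g‖]
  have hD : ‖x - c‖ ^ 2 ≤ 4 := by
    have := norm_sub_le x c
    nlinarith [norm_nonneg (x - c)]
  have hstep : ‖y - c‖ ^ 2 ≤ ‖x - c‖ ^ 2 - 2 * η * ⟪g, x - c⟫ + η ^ 2 * ‖g‖ ^ 2 := by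
    have h := norm_inv_max_smul_sub_sq_le (x - η • g) c hc
    rw [← hy, sub_right_comm, norm_sub_sq_real (x - c), real_inner_smul_right, norm_smul, mul_pow,
      Real.norm_eq_abs, sq_abs, real_inner_comm] at h
    linarith
  have hηS : η * S = √2 := by rw [hη]; field_simp
  have hη0 : 0 < η := by rw [hη]; positivity
  have hG : η * ‖g‖ ^ 2 ≤ 2 * √2 * (S - R) := by
    have h : ‖g‖ ^ 2 ≤ 2 * S * (S - R) := by nlinarith [sq_nonneg (S - R)]
    calc η * ‖g‖ ^ 2 ≤ η * (2 * S * (S - R)) := by gcongr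
      _ = 2 * (η * S) * (S - R) := by ring
      _ = _ := by rw [hηS]
  have hmul := mul_le_mul_of_nonneg_left hstep (by positivity : 0 ≤ √2 / 4 * S)
  have hcalc : √2 / 4 * S * (‖x - c‖ ^ 2 - 2 * η * ⟪g, x - c⟫ + η ^ 2 * ‖g‖ ^ 2)
      = √2 / 4 * S * ‖x - c‖ ^ 2 - ⟪g, x - c⟫ + η * ‖g‖ ^ 2 / 2 := by
    linear_combination (-(√2 / 2) * ⟪g, x - c⟫ + √2 / 4 * η * ‖g‖ ^ 2) * hηS
      + (-⟪g, x - c⟫ / 2 + η * ‖g‖ ^ 2 / 4) * hs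
  have hdiff := mul_le_mul_of_nonneg_left hD
    (mul_nonneg (by positivity : 0 ≤ √(2 : ℝ) / 4) (sub_nonneg.2 hRleS))
  linarith


open Finset RealInnerProductSpace in
/-- adaptive projected gradient descent on the unit ball (Algorithm 6 / Theorem 6).
`wc` is the comparator ẘ; `(max 1 ‖u‖)⁻¹ • u` is the projection of `u` onto the unit ball. -/
theorem stmt_9 {W : Type*} [NormedAddCommGroup W] [InnerProductSpace ℝ W]
    (T : ℕ) (hT : 1 ≤ T) (g w : ℕ → W) (η : ℕ → ℝ)
    (hpos : ∀ t ∈ Icc 1 T, 0 < ∑ i ∈ Icc 1 t, ‖g i‖ ^ 2)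
    (hη : ∀ t ∈ Icc 1 T, η t = Real.sqrt 2 / Real.sqrt (∑ i ∈ Icc 1 t, ‖g i‖ ^ 2))
    (hw1 : w 1 = 0)
    (hwrec : ∀ t ∈ Icc 1 T,
      w (t + 1) = (max 1 ‖w t - η t • g t‖)⁻¹ • (w t - η t • g t)) :
    ∀ wc : W, ‖wc‖ ≤ 1 →
      ∑ t ∈ Icc 1 T, ⟪g t, w t - wc⟫ ≤
        (2 : ℝ) ^ ((3 : ℝ) / 2) * Real.sqrt (∑ t ∈ Icc 1 T, ‖g t‖ ^ 2) := by
  intro wc hwc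
  have hw : ∀ n < T, ‖w (n + 1)‖ ≤ 1 := by
    rintro (_ | n) hn
    · simp [hw1]
    · rw [hwrec (n + 1) (mem_Icc.2 ⟨by omega, hn.le⟩)]
      exact norm_inv_max_smul_le_one _
  have key : ∀ n ≤ T, ∑ t ∈ Icc 1 n, ⟪g t, w t - wc⟫ ≤
      2 * √2 * √(∑ t ∈ Icc 1 n, ‖g t‖ ^ 2)
        - √2 / 4 * (√(∑ t ∈ Icc 1 n, ‖g t‖ ^ 2) * ‖w (n + 1) - wc‖ ^ 2) := by
    intro n
    induction n with
    | zero => simp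
    | succ n ih =>
      intro hn
      have hmem : n + 1 ∈ Icc 1 T := mem_Icc.2 ⟨by omega, hn⟩
      have hsum := sum_Icc_succ_top (by omega : 1 ≤ n + 1) (fun t => ‖g t‖ ^ 2)
      have hstep := inner_sub_le_of_projected_step (w (n + 1)) (w (n + 1 + 1)) (g (n + 1)) wc
        (η (n + 1)) (√(∑ t ∈ Icc 1 n, ‖g t‖ ^ 2)) (√(∑ t ∈ Icc 1 (n + 1), ‖g t‖ ^ 2))
        hwc (hw n hn) (Real.sqrt_nonneg _) (Real.sqrt_pos.2 (hpos _ hmem))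
        (by rw [Real.sq_sqrt (hpos _ hmem).le, Real.sq_sqrt (by positivity), hsum])
        (hη _ hmem) (hwrec _ hmem)
      rw [sum_Icc_succ_top (by omega : 1 ≤ n + 1) (fun t => ⟪g t, w t - wc⟫)]
      linarith [ih (by omega)]
  have hpow : (2 : ℝ) ^ ((3 : ℝ) / 2) = 2 * √2 := by
    rw [show (3 : ℝ) / 2 = 1 + 1 / 2 by norm_num, Real.rpow_add two_pos, Real.rpow_one,
      ← Real.sqrt_eq_rpow]
  rw [hpow]
  exact (key T le_rfl).trans (sub_le_self _ (by positivity))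
end

section
/- Let ε > 0, T ≥ 1, and let g_1,...,g_T and w_1,...,w_T be reals. Define Wealth_T = ε − Σ_{t=1}^T g_t w_t. Let f : ℝ → ℝ and suppose Wealth_T ≥ f(−Σ_{t=1}^T g_t). Then for every ẘ ∈ ℝ and every real M such that X·ẘ − f(X) ≤ M for all X ∈ ℝ, we have Σ_{t=1}^T g_t(w_t − ẘ) ≤ ε + M. -/
open Finset in
/-- wealth–regret duality of coin betting. `wc` plays the role of ẘ. -/
theorem stmt_10 (ε : ℝ) (hε : 0 < ε) (T : ℕ) (hT : 1 ≤ T) (g w : ℕ → ℝ) (f : ℝ → ℝ)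
    (hWealth : f (-∑ t ∈ Icc 1 T, g t) ≤ ε - ∑ t ∈ Icc 1 T, g t * w t)
    (wc M : ℝ) (hM : ∀ X : ℝ, X * wc - f X ≤ M) :
    ∑ t ∈ Icc 1 T, g t * (w t - wc) ≤ ε + M := by
  have h := hM (-∑ t ∈ Icc 1 T, g t)
  simp only [mul_sub, sum_sub_distrib, ← sum_mul]
  linarith
end

section
/- Let B ≥ 0 and g ∈ ℝ, and define ℓ̃(w) = (1/2)·(g·w + |g|·max(0, |w| − B)). Then for all w, ẘ ∈ ℝ, writing w̃ = clamp(w, [−B, B]) and ẘ̃ = clamp(ẘ, [−B, B]): g·(w̃ − ẘ) ≤ 2·(ℓ̃(w) − ℓ̃(ẘ)) + |g|·|ẘ − ẘ̃|. -/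
/-- The distance from `x` to its clamp onto `[-B, B]` is the excess of `|x|` over `B`. -/
theorem abs_sub_clamp_eq {B : ℝ} (hB : 0 ≤ B) (x : ℝ) :
    |x - max (-B) (min x B)| = max 0 (|x| - B) := by
  grind

/-- per-round inequality for the artificial-constraint reduction.
`wc` plays the role of the comparator ẘ; `max (-B) (min x B)` is clamp(x, [−B, B]). -/
theorem stmt_12 (B g : ℝ) (hB : 0 ≤ B) (w wc : ℝ) :
    g * (max (-B) (min w B) - wc) ≤
      2 * ((1 / 2) * (g * w + |g| * max 0 (|w| - B)) -
           (1 / 2) * (g * wc + |g| * max 0 (|wc| - B))) +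
        |g| * |wc - max (-B) (min wc B)| := by
  rw [← abs_sub_clamp_eq hB w, ← abs_sub_clamp_eq hB wc, ← abs_mul g (w - _)]
  linarith [neg_abs_le (g * (w - max (-B) (min w B)))]
end

section
/- Let W be a real inner product space, T ≥ 1, and let g_1,...,g_T ∈ W, y_1,...,y_T ∈ W with ‖y_t‖ ≤ 1 for all t, and x_1,...,x_T ∈ ℝ. Set w_t = x_t·y_t. Let ẘ ∈ W with ẘ ≠ 0. If Σ_{t=1}^T ⟨g_t, y_t⟩·(x_t − ‖ẘ‖) ≤ R₁ and Σ_{t=1}^T ⟨g_t, y_t − ẘ/‖ẘ‖⟩ ≤ R₂ with R₂ ≥ 0, then Σ_{t=1}^T ⟨g_t, w_t − ẘ⟩ ≤ R₁ + ‖ẘ‖·R₂. -/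
open Finset RealInnerProductSpace in
/-- one-dimensional-to-dimension-free reduction (behind Corollary 2).
`wc` is the comparator ẘ; `‖wc‖⁻¹ • wc` is ẘ/‖ẘ‖. -/
theorem stmt_15 {W : Type*} [NormedAddCommGroup W] [InnerProductSpace ℝ W]
    (T : ℕ) (hT : 1 ≤ T) (g y : ℕ → W) (x : ℕ → ℝ)
    (hy : ∀ t ∈ Icc 1 T, ‖y t‖ ≤ 1)
    (w : ℕ → W) (hw : ∀ t ∈ Icc 1 T, w t = x t • y t)
    (wc : W) (hwc : wc ≠ 0) (R₁ R₂ : ℝ) (hR₂ : 0 ≤ R₂)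
    (h1 : ∑ t ∈ Icc 1 T, ⟪g t, y t⟫ * (x t - ‖wc‖) ≤ R₁)
    (h2 : ∑ t ∈ Icc 1 T, ⟪g t, y t - ‖wc‖⁻¹ • wc⟫ ≤ R₂) :
    ∑ t ∈ Icc 1 T, ⟪g t, w t - wc⟫ ≤ R₁ + ‖wc‖ * R₂ := by
  have hn : ‖wc‖ ≠ 0 := norm_ne_zero_iff.mpr hwc
  have key : ∑ t ∈ Icc 1 T, ⟪g t, w t - wc⟫ =
      ∑ t ∈ Icc 1 T, ⟪g t, y t⟫ * (x t - ‖wc‖) +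
        ‖wc‖ * ∑ t ∈ Icc 1 T, ⟪g t, y t - ‖wc‖⁻¹ • wc⟫ := by
    rw [mul_sum, ← sum_add_distrib]
    refine sum_congr rfl fun t ht => ?_
    rw [hw t ht, inner_sub_right, inner_sub_right, real_inner_smul_right,
      real_inner_smul_right]
    field_simp
    ring
  rw [key]
  gcongr
end
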